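/- (Unique continuation for harmonic maps with torsion; Euclidean coordinate version.) Let D ⊆ ℝ^m be a connected open set and let Γ, A : ℝⁿ → (ℝⁿ ⊗ ℝⁿ → ℝⁿ) be smooth maps assigning to each point of ℝⁿ a bilinear map on ℝⁿ with values in ℝⁿ (the Christoffel symbols and the torsion endomorphism in local coordinates). Let φ, φ' : D → ℝⁿ be twice continuously differentiable maps that both solve the harmonic map with torsion system Δφ^α + ∑ᵢ Γ^α_{βγ}(φ) ∂ᵢφ^β ∂ᵢφ^γ + ∑ᵢ A^α_{βγ}(φ) ∂ᵢφ^β ∂ᵢφ^γ = 0 for α = 1,…,n on D. If φ = φ' on some nonempty open subset W ⊆ D, then φ = φ' on all of D. -/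

import Mathlib

open scoped RealInnerProductSpace BigOperators

/-- The partial derivative in the `i`-th coordinate direction of a map defined on
Euclidean space `ℝ^m`. -/
noncomputable def pd {m : ℕ} {F : Type*} [NormedAddCommGroup F] [NormedSpace ℝ F]
    (f : EuclideanSpace ℝ (Fin m) → F) (i : Fin m) (x : EuclideanSpace ℝ (Fin m)) : F :=
  fderiv ℝ f x (EuclideanSpace.single i 1)

open MeasureTheory

/-- `f` is differentiable at `x` with `i`-th partial derivative `d`. -/
def HP {m : ℕ} (f : EuclideanSpace ℝ (Fin m) → ℝ) (i : Fin m) (x : EuclideanSpace ℝ (Fin m))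
    (d : ℝ) : Prop :=
  ∃ f' : EuclideanSpace ℝ (Fin m) →L[ℝ] ℝ, HasFDerivAt f f' x ∧ f' (EuclideanSpace.single i 1) = d

section basics

variable {m : ℕ} {f g : EuclideanSpace ℝ (Fin m) → ℝ} {i : Fin m} {x : EuclideanSpace ℝ (Fin m)}
  {a b : ℝ}

lemma HP.pd_eq (h : HP f i x a) : pd f i x = a := by
  obtain ⟨f', h1, h2⟩ := h
  rw [pd, h1.fderiv, h2]

lemma HP.of_diff (h : DifferentiableAt ℝ f x) : HP f i x (pd f i x) :=
  ⟨fderiv ℝ f x, h.hasFDerivAt, rfl⟩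

lemma HP.congr (h : HP f i x a) (hab : a = b) : HP f i x b := hab ▸ h

lemma HP.add (hf : HP f i x a) (hg : HP g i x b) : HP (fun y => f y + g y) i x (a + b) := by
  obtain ⟨f', h1, h2⟩ := hf
  obtain ⟨g', h3, h4⟩ := hg
  exact ⟨f' + g', h1.add h3, by simp [h2, h4]⟩

lemma HP.sub (hf : HP f i x a) (hg : HP g i x b) : HP (fun y => f y - g y) i x (a - b) := by
  obtain ⟨f', h1, h2⟩ := hf
  obtain ⟨g', h3, h4⟩ := hg
  exact ⟨f' - g', h1.sub h3, by simp [h2, h4]⟩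

lemma HP.mul (hf : HP f i x a) (hg : HP g i x b) :
    HP (fun y => f y * g y) i x (a * g x + f x * b) := by
  obtain ⟨f', h1, h2⟩ := hf
  obtain ⟨g', h3, h4⟩ := hg
  refine ⟨_, h1.mul h3, ?_⟩
  simp [h2, h4]; ring

lemma HP.const (c : ℝ) : HP (fun _ => c) i x 0 := ⟨0, hasFDerivAt_const c x, by simp⟩

lemma HP.exp (hf : HP f i x a) : HP (fun y => Real.exp (f y)) i x (Real.exp (f x) * a) := by
  obtain ⟨f', h1, h2⟩ := hf
  exact ⟨_, h1.exp, by simp [h2]⟩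

lemma HP.sum {ι : Type*} (s : Finset ι) {F : ι → EuclideanSpace ℝ (Fin m) → ℝ} {A : ι → ℝ}
    (h : ∀ j ∈ s, HP (F j) i x (A j)) : HP (fun y => ∑ j ∈ s, F j y) i x (∑ j ∈ s, A j) := by
  classical
  induction s using Finset.induction_on with
  | empty => simpa using HP.const 0
  | insert j s hj ih =>
    simp only [Finset.sum_insert hj]
    exact (h j (by simp)).add (ih fun k hk => h k (by simp [hk]))

lemma HP.coord (z : EuclideanSpace ℝ (Fin m)) (j : Fin m) :
    HP (fun y => y j - z j) i x (if i = j then 1 else 0) := by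
  refine ⟨EuclideanSpace.proj j, ?_, ?_⟩
  · exact ((EuclideanSpace.proj j : EuclideanSpace ℝ (Fin m) →L[ℝ] ℝ).hasFDerivAt).sub_const _
  · simp [eq_comm]

/-- squared distance to `z`, in coordinates -/
def rho (z x : EuclideanSpace ℝ (Fin m)) : ℝ := ∑ j, (x j - z j) ^ 2

lemma rho_eq (z x : EuclideanSpace ℝ (Fin m)) : rho z x = ‖x - z‖ ^ 2 := by
  rw [EuclideanSpace.norm_sq_eq]; simp [rho]

lemma HP.rho (z : EuclideanSpace ℝ (Fin m)) : HP (rho z) i x (2 * (x i - z i)) := by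
  have : HP (fun y => ∑ j, (y j - z j) * (y j - z j)) i x _ :=
    HP.sum _ fun j _ => (HP.coord z j).mul (HP.coord z j)
  have h2 : (_root_.rho z) = (fun y => ∑ j, (y j - z j) * (y j - z j)) := by
    funext y; simp [_root_.rho, sq]
  rw [h2]
  refine this.congr ?_
  simp [Finset.sum_add_distrib]; ring

lemma contDiff_rho (z : EuclideanSpace ℝ (Fin m)) {n : WithTop ℕ∞} : ContDiff ℝ n (rho z) := by
  have : rho z = fun x => ‖x - z‖ ^ 2 := funext fun x => rho_eq z x
  rw [this]; exact (contDiff_id.sub contDiff_const).norm_sq ℝ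

lemma contDiff_coord (z : EuclideanSpace ℝ (Fin m)) (j : Fin m) {n : WithTop ℕ∞} :
    ContDiff ℝ n (fun y : EuclideanSpace ℝ (Fin m) => y j - z j) :=
  (EuclideanSpace.proj j : EuclideanSpace ℝ (Fin m) →L[ℝ] ℝ).contDiff.sub contDiff_const

lemma contDiff_pd {F : Type*} [NormedAddCommGroup F] [NormedSpace ℝ F]
    {f : EuclideanSpace ℝ (Fin m) → F} (hf : ContDiff ℝ 2 f) (i : Fin m) :
    ContDiff ℝ 1 (pd f i) :=
  (hf.fderiv_right (m := 1) (by norm_num)).clm_apply contDiff_const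

lemma continuous_pd {F : Type*} [NormedAddCommGroup F] [NormedSpace ℝ F]
    {f : EuclideanSpace ℝ (Fin m) → F} (hf : ContDiff ℝ 1 f) (i : Fin m) :
    Continuous (pd f i) :=
  (hf.continuous_fderiv (by norm_num)).clm_apply continuous_const

lemma compactSupport_pd {F : Type*} [NormedAddCommGroup F] [NormedSpace ℝ F]
    {f : EuclideanSpace ℝ (Fin m) → F} (hf : HasCompactSupport f) (i : Fin m) :
    HasCompactSupport (pd f i) :=
  hf.fderiv_apply (𝕜 := ℝ) _

lemma pd_comm (hf : ContDiff ℝ 2 f) (i j : Fin m) (x) : pd (pd f i) j x = pd (pd f j) i x := by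
  have hd : DifferentiableAt ℝ (fderiv ℝ f) x :=
    (hf.fderiv_right (m := 1) (by norm_num)).differentiable (by norm_num) x
  have key : ∀ i j : Fin m, pd (pd f i) j x
      = fderiv ℝ (fderiv ℝ f) x (EuclideanSpace.single j 1) (EuclideanSpace.single i 1) := by
    intro i j
    have := (hd.hasFDerivAt.clm_apply (hasFDerivAt_const (EuclideanSpace.single i (1:ℝ)) x)).fderiv
    unfold pd
    rw [this]; simp
  rw [key, key]
  exact (hf.contDiffAt.isSymmSndFDerivAt (by simp)).eq _ _

lemma integral_pd_eq_zero (hf : ContDiff ℝ 1 f) (hc : HasCompactSupport f) (i : Fin m) :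
    ∫ x, pd f i x = 0 := by
  have h := integral_mul_fderiv_eq_neg_fderiv_mul_of_integrable (μ := volume)
    (f := fun _ : EuclideanSpace ℝ (Fin m) => (1:ℝ)) (g := f) (v := EuclideanSpace.single i 1)
    (by simp)
    (by simp only [one_mul]
        exact (continuous_pd hf i).integrable_of_hasCompactSupport (compactSupport_pd hc i))
    (by simpa using hf.continuous.integrable_of_hasCompactSupport hc)
    (fun x _ => by fun_prop) (fun x _ => hf.differentiable (by norm_num) x)
  simpa [pd] using h

end basics

section carleman

variable {m : ℕ}

/-- first divergence term -/
noncomputable def D1 (z : EuclideanSpace ℝ (Fin m)) (c : ℝ) (w : EuclideanSpace ℝ (Fin m) → ℝ)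
    (i j : Fin m) (x : EuclideanSpace ℝ (Fin m)) : ℝ :=
  -2 * (x i - z i) * (x j - z j) * pd w i x * pd w j x
    + (if i = j then (c - rho z x) * pd w i x * pd w j x else 0)
    + (c - rho z x) * (x j - z j) * pd (pd w i) i x * pd w j x
    + (x j - z j) ^ 2 * pd w i x ^ 2 - (c - rho z x) * pd w i x ^ 2 / 2

lemma compactSupport_mul_of_left' {f g : EuclideanSpace ℝ (Fin m) → ℝ} (hf : HasCompactSupport f) :
    HasCompactSupport (fun x => g x * f x) := HasCompactSupport.mul_left hf

lemma D1_integral (z : EuclideanSpace ℝ (Fin m)) (c : ℝ) {w : EuclideanSpace ℝ (Fin m) → ℝ}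
    (hw : ContDiff ℝ 2 w) (hc : HasCompactSupport w) (i j : Fin m) :
    Integrable (D1 z c w i j) ∧ ∫ x, D1 z c w i j x = 0 := by
  have hr : ContDiff ℝ 1 (rho z) := contDiff_rho z
  have hi := contDiff_pd hw i
  have hj := contDiff_pd hw j
  have hy := contDiff_coord z j (n := 1)
  set F1 : EuclideanSpace ℝ (Fin m) → ℝ :=
    fun x => (((c - rho z x) * (x j - z j)) * pd w j x) * pd w i x with hF1
  set F2 : EuclideanSpace ℝ (Fin m) → ℝ :=
    fun x => (((c - rho z x) * (x j - z j)) * pd w i x) * pd w i x with hF2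
  have c1 : ContDiff ℝ 1 F1 := (((contDiff_const.sub hr).mul hy).mul hj).mul hi
  have c2 : ContDiff ℝ 1 F2 := (((contDiff_const.sub hr).mul hy).mul hi).mul hi
  have s1 : HasCompactSupport F1 := compactSupport_mul_of_left' (compactSupport_pd hc i)
  have s2 : HasCompactSupport F2 := compactSupport_mul_of_left' (compactSupport_pd hc i)
  have key : D1 z c w i j = fun x => pd F1 i x - pd F2 j x / 2 := by
    funext x
    have di : ∀ k, HP (pd w i) k x _ := fun k => HP.of_diff (hi.differentiable (by norm_num) x)
    have dj : ∀ k, HP (pd w j) k x _ := fun k => HP.of_diff (hj.differentiable (by norm_num) x)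
    have e1 : HP F1 i x _ :=
      ((((HP.const c).sub (HP.rho z)).mul (HP.coord z j)).mul (dj i)).mul (di i)
    have e2 : HP F2 j x _ :=
      ((((HP.const c).sub (HP.rho z)).mul (HP.coord z j)).mul (di j)).mul (di j)
    rw [e1.pd_eq, e2.pd_eq, pd_comm hw i j x, D1]
    by_cases hij : i = j
    · subst hij; simp; ring
    · simp [hij]; ring
  have i1 := (continuous_pd c1 i).integrable_of_hasCompactSupport (μ := volume)
    (compactSupport_pd s1 i)
  have i2 := (continuous_pd c2 j).integrable_of_hasCompactSupport (μ := volume)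
    (compactSupport_pd s2 j)
  rw [key]
  refine ⟨i1.sub (i2.div_const 2), ?_⟩
  rw [integral_sub i1 (i2.div_const 2), integral_div, integral_pd_eq_zero c1 s1,
    integral_pd_eq_zero c2 s2]
  simp

/-- second divergence term -/
noncomputable def D2 (z : EuclideanSpace ℝ (Fin m)) (c h T : ℝ) (w : EuclideanSpace ℝ (Fin m) → ℝ)
    (i : Fin m) (x : EuclideanSpace ℝ (Fin m)) : ℝ :=
  -2 * T * ((8 + 4 * m) * (x i - z i) * w x * pd w i x
      + (4 * c - (4 + 2 * m) * (c - rho z x) + 2 * h) * pd w i x ^ 2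
      + (4 * c - (4 + 2 * m) * (c - rho z x) + 2 * h) * w x * pd (pd w i) i x)
    + T * (8 + 4 * m) * (w x ^ 2 + 2 * (x i - z i) * w x * pd w i x)
    + 4 * T * (-2 * (4 * T ^ 2 * (3 * (c - rho z x) ^ 2 * c - 4 * (c - rho z x) ^ 3) + 2 * T * h)
        * (x i - z i) ^ 2 * w x ^ 2
      + (4 * T ^ 2 * (c - rho z x) ^ 3 * rho z x + 2 * T * h * (c - rho z x)) * w x ^ 2
      + 2 * (4 * T ^ 2 * (c - rho z x) ^ 3 * rho z x + 2 * T * h * (c - rho z x))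
        * (x i - z i) * w x * pd w i x)

lemma D2_integral (z : EuclideanSpace ℝ (Fin m)) (c h T : ℝ) {w : EuclideanSpace ℝ (Fin m) → ℝ}
    (hw : ContDiff ℝ 2 w) (hc : HasCompactSupport w) (i : Fin m) :
    Integrable (D2 z c h T w i) ∧ ∫ x, D2 z c h T w i x = 0 := by
  have hr : ContDiff ℝ 1 (rho z) := contDiff_rho z
  have hi := contDiff_pd hw i
  have hw1 : ContDiff ℝ 1 w := hw.of_le (by norm_num)
  have hy := contDiff_coord z i (n := 1)
  have hs : ContDiff ℝ 1 (fun x => c - rho z x) := contDiff_const.sub hr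
  set F : EuclideanSpace ℝ (Fin m) → ℝ :=
    fun x => (((-2 * T) * (4 * c - (4 + 2 * m) * (c - rho z x) + 2 * h)) * pd w i x
      + (T * (8 + 4 * m) * (x i - z i)) * w x
      + ((4 * T) * ((4 * T ^ 2) * ((c - rho z x) * ((c - rho z x) * ((c - rho z x) * rho z x)))
        + (2 * T * h) * (c - rho z x)) * (x i - z i)) * w x) * w x with hF
  have c1 : ContDiff ℝ 1 F := by
    refine ContDiff.mul (((ContDiff.mul ?_ hi).add (ContDiff.mul ?_ hw1)).add
      (ContDiff.mul (ContDiff.mul ?_ hy) hw1)) hw1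
    · exact contDiff_const.mul ((contDiff_const.sub (contDiff_const.mul hs)).add contDiff_const)
    · exact contDiff_const.mul hy
    · exact contDiff_const.mul ((contDiff_const.mul (hs.mul (hs.mul (hs.mul hr)))).add
        (contDiff_const.mul hs))
  have s1 : HasCompactSupport F := compactSupport_mul_of_left' hc
  have key : D2 z c h T w i = fun x => pd F i x := by
    funext x
    have di : HP (pd w i) i x _ := HP.of_diff (hi.differentiable (by norm_num) x)
    have d0 : HP w i x _ := HP.of_diff (hw1.differentiable (by norm_num) x)
    have ds : HP (fun x => c - rho z x) i x _ := (HP.const c).sub (HP.rho z)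
    have dy := HP.coord (i := i) (x := x) z i
    have e1 : HP F i x _ :=
      (((((HP.const _).mul (((HP.const _).sub ((HP.const _).mul ds)).add (HP.const _))).mul di).add
        (((HP.const _).mul dy).mul d0)).add
        ((((HP.const _).mul (((HP.const _).mul (ds.mul (ds.mul (ds.mul (HP.rho z))))).add
          ((HP.const _).mul ds))).mul dy).mul d0)).mul d0
    rw [e1.pd_eq, D2]
    simp only [if_true]
    ring
  have i1 := (continuous_pd c1 i).integrable_of_hasCompactSupport (μ := volume)
    (compactSupport_pd s1 i)
  rw [key]
  exact ⟨i1, integral_pd_eq_zero c1 s1 i⟩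

/-- Laplacian in coordinates -/
noncomputable def lap (w : EuclideanSpace ℝ (Fin m) → ℝ) (x : EuclideanSpace ℝ (Fin m)) : ℝ :=
  ∑ i, pd (pd w i) i x

/-- squared norm of the gradient -/
noncomputable def gsq (w : EuclideanSpace ℝ (Fin m) → ℝ) (x : EuclideanSpace ℝ (Fin m)) : ℝ :=
  ∑ i, pd w i x ^ 2

/-- radial derivative -/
noncomputable def rad (z : EuclideanSpace ℝ (Fin m)) (w : EuclideanSpace ℝ (Fin m) → ℝ)
    (x : EuclideanSpace ℝ (Fin m)) : ℝ :=
  ∑ i, (x i - z i) * pd w i x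

/-- conjugated Laplacian -/
noncomputable def Lop (z : EuclideanSpace ℝ (Fin m)) (c T : ℝ)
    (w : EuclideanSpace ℝ (Fin m) → ℝ) (x : EuclideanSpace ℝ (Fin m)) : ℝ :=
  lap w x + 4 * T * (c - rho z x) * rad z w x
    + (4 * T ^ 2 * (c - rho z x) ^ 2 * rho z x - T * (4 * rho z x - 2 * m * (c - rho z x))) * w x

lemma D1_sum (z : EuclideanSpace ℝ (Fin m)) (c : ℝ) (w : EuclideanSpace ℝ (Fin m) → ℝ) (x) :
    ∑ i, ∑ j, D1 z c w i j x = -2 * rad z w x ^ 2 + (c - rho z x) * gsq w x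
      + (c - rho z x) * rad z w x * lap w x + rho z x * gsq w x
      - m / 2 * (c - rho z x) * gsq w x := by
  have e1 : ∑ i, ∑ j, -2 * (x i - z i) * (x j - z j) * pd w i x * pd w j x
      = -2 * rad z w x ^ 2 := by
    rw [sq, rad, Finset.sum_mul_sum, Finset.mul_sum]
    refine Finset.sum_congr rfl fun i _ => ?_
    rw [Finset.mul_sum]
    exact Finset.sum_congr rfl fun j _ => by ring
  have e2 : ∑ i, ∑ j, (if i = j then (c - rho z x) * pd w i x * pd w j x else 0)
      = (c - rho z x) * gsq w x := by
    simp only [Finset.sum_ite_eq, Finset.mem_univ, if_true]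
    rw [gsq, Finset.mul_sum]
    exact Finset.sum_congr rfl fun j _ => by ring
  have e3 : ∑ i, ∑ j, (c - rho z x) * (x j - z j) * pd (pd w i) i x * pd w j x
      = (c - rho z x) * rad z w x * lap w x := by
    rw [mul_assoc, mul_comm (rad z w x), lap, rad, Finset.sum_mul_sum, Finset.mul_sum]
    refine Finset.sum_congr rfl fun i _ => ?_
    rw [Finset.mul_sum]
    exact Finset.sum_congr rfl fun j _ => by ring
  have e4 : ∑ i, ∑ j, (x j - z j) ^ 2 * pd w i x ^ 2 = rho z x * gsq w x := by
    rw [mul_comm, gsq, rho, Finset.sum_mul_sum]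
    refine Finset.sum_congr rfl fun i _ => Finset.sum_congr rfl fun j _ => by ring
  have e5 : ∑ i, ∑ _j : Fin m, (c - rho z x) * pd w i x ^ 2 / 2
      = m / 2 * (c - rho z x) * gsq w x := by
    simp only [Finset.sum_const, Finset.card_univ, Fintype.card_fin, nsmul_eq_mul]
    rw [gsq, Finset.mul_sum]
    exact Finset.sum_congr rfl fun j _ => by ring
  simp only [D1, Finset.sum_add_distrib, Finset.sum_sub_distrib]
  rw [e1, e2, e3, e4, e5]

lemma D2_sum (z : EuclideanSpace ℝ (Fin m)) (c h T : ℝ) (w : EuclideanSpace ℝ (Fin m) → ℝ) (x) :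
    ∑ i, D2 z c h T w i x =
    -2 * T * ((8 + 4 * m) * w x * rad z w x
      + (4 * c - (4 + 2 * m) * (c - rho z x) + 2 * h) * gsq w x
      + (4 * c - (4 + 2 * m) * (c - rho z x) + 2 * h) * w x * lap w x)
    + T * (8 + 4 * m) * (m * w x ^ 2 + 2 * w x * rad z w x)
    + 4 * T * (-2 * (4 * T ^ 2 * (3 * (c - rho z x) ^ 2 * c - 4 * (c - rho z x) ^ 3) + 2 * T * h)
        * rho z x * w x ^ 2
      + m * (4 * T ^ 2 * (c - rho z x) ^ 3 * rho z x + 2 * T * h * (c - rho z x)) * w x ^ 2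
      + 2 * (4 * T ^ 2 * (c - rho z x) ^ 3 * rho z x + 2 * T * h * (c - rho z x))
        * w x * rad z w x) := by
  set σ := c - rho z x with hσ
  set k := 4 * c - (4 + 2 * m) * σ + 2 * h with hk
  set q := 4 * T ^ 2 * σ ^ 3 * rho z x + 2 * T * h * σ with hq
  set q' := 4 * T ^ 2 * (3 * σ ^ 2 * c - 4 * σ ^ 3) + 2 * T * h with hq'
  have e : ∀ i, D2 z c h T w i x = (-2 * T * (8 + 4 * m) * w x + 2 * T * (8 + 4 * m) * w x
      + 8 * T * q * w x) * ((x i - z i) * pd w i x) + (-2 * T * k) * pd w i x ^ 2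
      + (-2 * T * k * w x) * pd (pd w i) i x + (-8 * T * q' * w x ^ 2) * (x i - z i) ^ 2
      + (T * (8 + 4 * m) * w x ^ 2 + 4 * T * q * w x ^ 2) := by
    intro i
    simp only [D2, ← hσ, ← hk, ← hq, ← hq']
    ring
  simp only [e, Finset.sum_add_distrib, ← Finset.mul_sum]
  simp only [Finset.sum_const, Finset.card_univ, Fintype.card_fin, nsmul_eq_mul]
  change _ * rad z w x + _ * gsq w x + _ * lap w x + _ * rho z x + _ = _
  ring

lemma pointwise_ineq {M δ s T ρ σ c G P Λ w : ℝ} (hc : c = ρ + σ) (hδ : 0 < δ) (hs : 0 < s)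
    (hδs : 3 * δ ≤ s ^ 2) (hT : 0 < T)
    (hT' : 200 * δ ^ 2 * T ^ 2 + T * (8 + 4 * M) * M ≤ 8 * δ ^ 2 * s ^ 4 * T ^ 3)
    (hG : 0 ≤ G)
    (hreg : (w = 0 ∧ G = 0 ∧ P = 0) ∨ (s ^ 2 ≤ ρ ∧ δ ≤ σ ∧ σ ≤ 2 * δ)) :
    8 * T * (-2 * P ^ 2 + σ * G + σ * P * Λ + ρ * G - M / 2 * σ * G)
    + (-2 * T * ((8 + 4 * M) * w * P
      + (4 * c - (4 + 2 * M) * σ + 2 * (5 * δ)) * G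
      + (4 * c - (4 + 2 * M) * σ + 2 * (5 * δ)) * w * Λ)
    + T * (8 + 4 * M) * (M * w ^ 2 + 2 * w * P)
    + 4 * T * (-2 * (4 * T ^ 2 * (3 * σ ^ 2 * c - 4 * σ ^ 3) + 2 * T * (5 * δ))
        * ρ * w ^ 2
      + M * (4 * T ^ 2 * σ ^ 3 * ρ + 2 * T * (5 * δ) * σ) * w ^ 2
      + 2 * (4 * T ^ 2 * σ ^ 3 * ρ + 2 * T * (5 * δ) * σ) * w * P))
    + (4 * δ * T * G + 8 * δ ^ 2 * s ^ 4 * T ^ 3 * w ^ 2)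
    ≤ (Λ + 4 * T * σ * P + (4 * T ^ 2 * σ ^ 2 * ρ - T * (4 * ρ - 2 * M * σ)) * w) ^ 2 := by
  subst hc
  have main : 4 * δ * T * G + 8 * δ ^ 2 * s ^ 4 * T ^ 3 * w ^ 2 ≤
      4 * T * (-2 * σ * G + 4 * P ^ 2 + 5 * δ * G)
      + (4 * T ^ 3 * (4 * σ ^ 2 * ρ) * (4 * ρ - 2 * σ - 5 * δ) - 8 * T ^ 2 * (5 * δ) ^ 2
        - T * (8 + 4 * M) * M) * w ^ 2 := by
    rcases hreg with ⟨h1, h2, h3⟩ | ⟨h1, h2, h3⟩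
    · simp [h1, h2, h3]
    · have a1 : 4 * δ * T * G ≤ 4 * T * (-2 * σ * G + 4 * P ^ 2 + 5 * δ * G) := by
        have : 0 ≤ 4 * T * ((4 * δ - 2 * σ) * G + 4 * P ^ 2) := by
          have : 0 ≤ 4 * δ - 2 * σ := by linarith
          positivity
        linarith
      have a2 : s ^ 2 ≤ 4 * ρ - 2 * σ - 5 * δ := by linarith
      have a3 : δ ^ 2 * s ^ 2 * s ^ 2 ≤ σ ^ 2 * ρ * (4 * ρ - 2 * σ - 5 * δ) := by
        have : 0 ≤ ρ := (sq_nonneg s).trans h1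
        gcongr
      have a4 : 8 * δ ^ 2 * s ^ 4 * T ^ 3 ≤
          4 * T ^ 3 * (4 * σ ^ 2 * ρ) * (4 * ρ - 2 * σ - 5 * δ) - 8 * T ^ 2 * (5 * δ) ^ 2
          - T * (8 + 4 * M) * M := by
        have := mul_le_mul_of_nonneg_left a3 (by positivity : 0 ≤ 16 * T ^ 3)
        linarith
      have a5 := mul_le_mul_of_nonneg_right a4 (sq_nonneg w)
      linarith
  nlinarith [sq_nonneg (Λ + (4 * T ^ 2 * σ ^ 2 * ρ + 2 * T * (5 * δ)) * w),
    sq_nonneg (4 * T * σ * P - T * (4 * ρ - 2 * M * σ + 2 * (5 * δ)) * w)]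

lemma continuous_lap {w : EuclideanSpace ℝ (Fin m) → ℝ} (hw : ContDiff ℝ 2 w) :
    Continuous (lap w) :=
  continuous_finsetSum _ fun i _ => continuous_pd (contDiff_pd hw i) i

lemma continuous_gsq {w : EuclideanSpace ℝ (Fin m) → ℝ} (hw : ContDiff ℝ 2 w) :
    Continuous (gsq w) :=
  continuous_finsetSum _ fun i _ => (contDiff_pd hw i).continuous.pow 2

lemma continuous_rad (z : EuclideanSpace ℝ (Fin m)) {w : EuclideanSpace ℝ (Fin m) → ℝ}
    (hw : ContDiff ℝ 2 w) : Continuous (rad z w) :=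
  continuous_finsetSum _ fun i _ =>
    (contDiff_coord z i (n := 1)).continuous.mul (contDiff_pd hw i).continuous

lemma pd_zero_of_nmem {F : Type*} [NormedAddCommGroup F] [NormedSpace ℝ F]
    {f : EuclideanSpace ℝ (Fin m) → F} {x : EuclideanSpace ℝ (Fin m)}
    (hx : x ∉ tsupport f) (i : Fin m) : pd f i x = 0 := by
  have : fderiv ℝ f x = 0 := by
    by_contra h
    exact hx (support_fderiv_subset ℝ (by simpa using h))
  simp [pd, this]

lemma tsupport_pd {F : Type*} [NormedAddCommGroup F] [NormedSpace ℝ F]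
    (f : EuclideanSpace ℝ (Fin m) → F) (i : Fin m) : tsupport (pd f i) ⊆ tsupport f := by
  refine closure_minimal (fun x hx => ?_) (isClosed_tsupport f)
  by_contra h
  exact hx (pd_zero_of_nmem h i)

lemma w_zero {w : EuclideanSpace ℝ (Fin m) → ℝ} {x} (hx : x ∉ tsupport w) :
    w x = 0 ∧ gsq w x = 0 ∧ lap w x = 0 ∧ ∀ z, rad z w x = 0 := by
  refine ⟨image_eq_zero_of_notMem_tsupport hx, ?_, ?_, fun z => ?_⟩
  · simp [gsq, pd_zero_of_nmem hx]
  · simp only [lap]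
    exact Finset.sum_eq_zero fun i _ => pd_zero_of_nmem (fun h => hx (tsupport_pd w i h)) i
  · simp [rad, pd_zero_of_nmem hx]

lemma carleman (z : EuclideanSpace ℝ (Fin m)) {δ s T : ℝ} (hδ : 0 < δ) (hs : 0 < s)
    (hδs : 3 * δ ≤ s ^ 2) (hT : 0 < T)
    (hT' : 200 * δ ^ 2 * T ^ 2 + T * (8 + 4 * m) * m ≤ 8 * δ ^ 2 * s ^ 4 * T ^ 3)
    {w : EuclideanSpace ℝ (Fin m) → ℝ} (hw : ContDiff ℝ 2 w) (hc : HasCompactSupport w)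
    (hsupp : ∀ x ∈ tsupport w, s ^ 2 ≤ rho z x ∧ rho z x ≤ s ^ 2 + δ) :
    4 * δ * T * (∫ x, gsq w x) + 8 * δ ^ 2 * s ^ 4 * T ^ 3 * (∫ x, w x ^ 2)
      ≤ ∫ x, (Lop z (s ^ 2 + 2 * δ) T w x) ^ 2 := by
  set c := s ^ 2 + 2 * δ with hcdef
  have iG : Integrable (gsq w) :=
    (continuous_gsq hw).integrable_of_hasCompactSupport
      (HasCompactSupport.intro hc fun x hx => (w_zero hx).2.1)
  have iw : Integrable (fun x => w x ^ 2) :=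
    (hw.continuous.pow 2).integrable_of_hasCompactSupport
      (HasCompactSupport.intro hc fun x hx => by simp [(w_zero hx).1])
  have iL : Integrable (fun x => (Lop z c T w x) ^ 2) := by
    refine Continuous.integrable_of_hasCompactSupport ?_
      (HasCompactSupport.intro hc fun x hx => ?_)
    · have h1 := continuous_lap hw
      have h2 := continuous_rad z hw
      have h3 := (contDiff_rho z (n := 1)).continuous
      have h4 := hw.continuous
      unfold Lop
      fun_prop
    · obtain ⟨h1, h2, h3, h4⟩ := w_zero hx
      simp [Lop, h1, h3, h4]
  have i1 : ∀ i ∈ Finset.univ, Integrable (fun x => ∑ j, D1 z c w i j x) := fun i _ =>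
    integrable_finsetSum _ fun j _ => (D1_integral z c hw hc i j).1
  have i1' : Integrable (fun x => ∑ i, ∑ j, D1 z c w i j x) := integrable_finsetSum _ i1
  have z1 : ∫ x, ∑ i, ∑ j, D1 z c w i j x = 0 := by
    rw [integral_finsetSum _ i1]
    refine Finset.sum_eq_zero fun i _ => ?_
    rw [integral_finsetSum _ fun j _ => (D1_integral z c hw hc i j).1]
    exact Finset.sum_eq_zero fun j _ => (D1_integral z c hw hc i j).2
  have i2' : Integrable (fun x => ∑ i, D2 z c (5 * δ) T w i x) :=
    integrable_finsetSum _ fun i _ => (D2_integral z c (5 * δ) T hw hc i).1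
  have z2 : ∫ x, ∑ i, D2 z c (5 * δ) T w i x = 0 := by
    rw [integral_finsetSum _ fun i _ => (D2_integral z c (5 * δ) T hw hc i).1]
    exact Finset.sum_eq_zero fun i _ => (D2_integral z c (5 * δ) T hw hc i).2
  have key : ∀ x, (8 * T * ∑ i, ∑ j, D1 z c w i j x) + (∑ i, D2 z c (5 * δ) T w i x)
      + (4 * δ * T * gsq w x + 8 * δ ^ 2 * s ^ 4 * T ^ 3 * w x ^ 2)
      ≤ (Lop z c T w x) ^ 2 := by
    intro x
    rw [D1_sum, D2_sum, Lop]
    refine pointwise_ineq (by ring) hδ hs hδs hT hT' (Finset.sum_nonneg fun i _ => sq_nonneg _) ?_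
    by_cases hx : x ∈ tsupport w
    · right
      obtain ⟨h1, h2⟩ := hsupp x hx
      exact ⟨h1, by linarith, by linarith⟩
    · left
      obtain ⟨h1, h2, h3, h4⟩ := w_zero hx
      exact ⟨h1, h2, h4 z⟩
  have := integral_mono (((i1'.const_mul (8 * T)).add i2').add
    ((iG.const_mul (4 * δ * T)).add (iw.const_mul (8 * δ ^ 2 * s ^ 4 * T ^ 3)))) iL key
  rw [integral_add' ((i1'.const_mul (8 * T)).add i2')
      ((iG.const_mul (4 * δ * T)).add (iw.const_mul (8 * δ ^ 2 * s ^ 4 * T ^ 3))),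
    integral_add' (i1'.const_mul (8 * T)) i2',
    integral_add' (iG.const_mul (4 * δ * T)) (iw.const_mul (8 * δ ^ 2 * s ^ 4 * T ^ 3)),
    integral_const_mul, integral_const_mul, integral_const_mul, z1, z2] at this
  simpa using this

end carleman

section absorb

variable {m : ℕ}

/-- the Carleman weight `exp (T ψ)` -/
noncomputable def wt (z : EuclideanSpace ℝ (Fin m)) (c κ T : ℝ) (x : EuclideanSpace ℝ (Fin m)) : ℝ :=
  Real.exp ((T / 2) * ((c - rho z x) * (c - rho z x) - κ))

lemma hp_wt (z : EuclideanSpace ℝ (Fin m)) (c κ T : ℝ) (i : Fin m) (x) :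
    HP (wt z c κ T) i x (wt z c κ T x * (-2 * T * (c - rho z x) * (x i - z i))) := by
  have ds : HP (fun x => c - _root_.rho z x) i x _ := (HP.const c).sub (HP.rho z)
  have := ((HP.const (T / 2)).mul ((ds.mul ds).sub (HP.const κ))).exp
  refine this.congr ?_
  unfold wt
  ring

lemma contDiff_wt (z : EuclideanSpace ℝ (Fin m)) (c κ T : ℝ) {n : WithTop ℕ∞} :
    ContDiff ℝ n (wt z c κ T) := by
  have h := contDiff_rho z (n := n)
  unfold wt
  fun_prop

lemma pd_wt_mul (z : EuclideanSpace ℝ (Fin m)) (c κ T : ℝ) {v : EuclideanSpace ℝ (Fin m) → ℝ}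
    (hv : ContDiff ℝ 2 v) (i : Fin m) (x) :
    pd (fun x => wt z c κ T x * v x) i x
      = wt z c κ T x * (pd v i x - 2 * T * (c - rho z x) * (x i - z i) * v x) := by
  have d0 : HP v i x _ := HP.of_diff (hv.differentiable (by norm_num) x)
  rw [((hp_wt z c κ T i x).mul d0).pd_eq]
  ring

lemma pd_pd_wt_mul (z : EuclideanSpace ℝ (Fin m)) (c κ T : ℝ) {v : EuclideanSpace ℝ (Fin m) → ℝ}
    (hv : ContDiff ℝ 2 v) (i : Fin m) (x) :
    pd (pd (fun x => wt z c κ T x * v x) i) i x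
      = wt z c κ T x * (pd (pd v i) i x - 4 * T * (c - rho z x) * ((x i - z i) * pd v i x)
        - 2 * T * (c - rho z x) * v x + (4 * T * v x) * (x i - z i) ^ 2
        + (4 * T ^ 2 * (c - rho z x) ^ 2 * v x) * (x i - z i) ^ 2) := by
  have e : pd (fun x => wt z c κ T x * v x) i = fun x =>
      wt z c κ T x * (pd v i x - ((2 * T) * ((c - rho z x) * (x i - z i))) * v x) := by
    funext y; rw [pd_wt_mul z c κ T hv]; ring
  have d0 : HP v i x _ := HP.of_diff (hv.differentiable (by norm_num) x)
  have d1 : HP (pd v i) i x _ := HP.of_diff ((contDiff_pd hv i).differentiable (by norm_num) x)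
  have ds : HP (fun x => c - _root_.rho z x) i x _ := (HP.const c).sub (HP.rho z)
  have dy := HP.coord (i := i) (x := x) z i
  rw [e, ((hp_wt z c κ T i x).mul (d1.sub (((HP.const (2 * T)).mul (ds.mul dy)).mul d0))).pd_eq]
  simp only [if_true]
  ring

lemma Lop_wt_mul (z : EuclideanSpace ℝ (Fin m)) (c κ T : ℝ) {v : EuclideanSpace ℝ (Fin m) → ℝ}
    (hv : ContDiff ℝ 2 v) (x) :
    Lop z c T (fun x => wt z c κ T x * v x) x = wt z c κ T x * lap v x := by
  have h1 : lap (fun x => wt z c κ T x * v x) x = wt z c κ T x * (lap v x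
      - 4 * T * (c - rho z x) * rad z v x - m * (2 * T * (c - rho z x) * v x)
      + (4 * T * v x) * rho z x + (4 * T ^ 2 * (c - rho z x) ^ 2 * v x) * rho z x) := by
    simp only [lap, pd_pd_wt_mul z c κ T hv, ← Finset.mul_sum, Finset.sum_add_distrib,
      Finset.sum_sub_distrib]
    simp only [Finset.sum_const, Finset.card_univ, Fintype.card_fin, nsmul_eq_mul]
    simp only [rad, rho]
    ring
  have h2 : rad z (fun x => wt z c κ T x * v x) x
      = wt z c κ T x * (rad z v x - 2 * T * (c - rho z x) * v x * rho z x) := by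
    simp only [rad, pd_wt_mul z c κ T hv]
    rw [rho, Finset.mul_sum, ← Finset.sum_sub_distrib, Finset.mul_sum]
    exact Finset.sum_congr rfl fun i _ => by ring
  rw [Lop, h1, h2]
  ring

lemma gsq_wt_mul (z : EuclideanSpace ℝ (Fin m)) (c κ T : ℝ) {v : EuclideanSpace ℝ (Fin m) → ℝ}
    (hv : ContDiff ℝ 2 v) (x) :
    wt z c κ T x ^ 2 * gsq v x ≤ 2 * gsq (fun x => wt z c κ T x * v x) x
      + 8 * T ^ 2 * (c - rho z x) ^ 2 * rho z x * (wt z c κ T x * v x) ^ 2 := by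
  simp only [gsq, pd_wt_mul z c κ T hv]
  have : 8 * T ^ 2 * (c - rho z x) ^ 2 * rho z x * (wt z c κ T x * v x) ^ 2
    = ∑ i, 8 * T ^ 2 * (c - rho z x) ^ 2 * (wt z c κ T x * v x) ^ 2 * (x i - z i) ^ 2 := by
    rw [← Finset.mul_sum]; change _ = _ * rho z x; ring
  rw [this, Finset.mul_sum, Finset.mul_sum, ← Finset.sum_add_distrib]
  refine Finset.sum_le_sum fun i _ => ?_
  nlinarith [sq_nonneg (wt z c κ T x * (pd v i x - 4 * T * (c - rho z x) * (x i - z i) * v x))]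

set_option maxHeartbeats 1000000 in
lemma absorb {n : ℕ} (z : EuclideanSpace ℝ (Fin m)) {δ δ₁ s C : ℝ} (hδ : 0 < δ) (hs : 0 < s)
    (hδ₁ : 0 < δ₁) (hδ₁' : δ₁ ≤ δ)
    (hδs : 3 * δ ≤ s ^ 2) (hC : 0 ≤ C)
    (v : Fin n → EuclideanSpace ℝ (Fin m) → ℝ) (hv : ∀ α, ContDiff ℝ 2 (v α))
    (hc : ∀ α, HasCompactSupport (v α))
    (hsupp : ∀ α, ∀ x ∈ tsupport (v α), s ^ 2 ≤ rho z x ∧ rho z x ≤ s ^ 2 + δ)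
    (hineq : ∀ x, rho z x < s ^ 2 + δ₁ →
      ∑ α, lap (v α) x ^ 2 ≤ C * ∑ α, (v α x ^ 2 + gsq (v α) x)) :
    ∀ α, ∀ x, rho z x < s ^ 2 + δ₁ → v α x = 0 := by
  intro α₀ x₀ hx₀
  by_contra hne
  set c := s ^ 2 + 2 * δ with hcdef
  set κ := (2 * δ - δ₁) ^ 2 with hκ
  -- integrability facts
  have iF : ∀ α, Integrable (fun x => lap (v α) x ^ 2) := fun α =>
    ((continuous_lap (hv α)).pow 2).integrable_of_hasCompactSupport
      (HasCompactSupport.intro (hc α) fun x hx => by simp [(w_zero hx).2.2.1])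
  set J := ∫ x, ∑ α, lap (v α) x ^ 2 with hJ
  -- lower bound
  set g : EuclideanSpace ℝ (Fin m) → ℝ := fun x => max 0 (s ^ 2 + δ₁ - rho z x) * v α₀ x ^ 2 with hg
  have gcont : Continuous g := by
    have h3 := (contDiff_rho z (n := 1)).continuous
    have h4 := (hv α₀).continuous
    fun_prop
  have gsupp : HasCompactSupport g := HasCompactSupport.intro (hc α₀) fun x hx => by
    simp [g, (w_zero hx).1]
  have gnn : 0 ≤ g := fun x => mul_nonneg (le_max_left _ _) (sq_nonneg _)
  have gpos : 0 < ∫ x, g x := by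
    refine gcont.integral_pos_of_hasCompactSupport_nonneg_nonzero gsupp gnn (x := x₀) ?_
    have : 0 < max 0 (s ^ 2 + δ₁ - rho z x₀) := lt_max_of_lt_right (by linarith)
    exact mul_ne_zero this.ne' (pow_ne_zero _ hne)
  set I := ∫ x, g x with hI
  set S := s ^ 2 + δ₁ with hS
  have hSpos : 0 < S := by positivity
  set a := 8 * δ ^ 2 * s ^ 4 with ha
  have hapos : 0 < a := by positivity
  obtain ⟨T, t1, t2, t3, t4, t5⟩ : ∃ T : ℝ, 1 ≤ T ∧ (200 * δ ^ 2 + (8 + 4 * m) * m) / a ≤ T ∧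
      (1 + C + 64 * C * δ ^ 2 * s ^ 2) / a ≤ T ∧ 2 * C / (4 * δ) ≤ T ∧ (J * S + 1) / I ≤ T := by
    have := (Filter.eventually_ge_atTop (1:ℝ)).and ((Filter.eventually_ge_atTop
      ((200 * δ ^ 2 + (8 + 4 * m) * m) / a)).and ((Filter.eventually_ge_atTop
      ((1 + C + 64 * C * δ ^ 2 * s ^ 2) / a)).and ((Filter.eventually_ge_atTop
      (2 * C / (4 * δ))).and (Filter.eventually_ge_atTop ((J * S + 1) / I)))))
    exact this.exists
  rw [div_le_iff₀ hapos] at t2 t3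
  rw [div_le_iff₀ (by positivity)] at t4
  rw [div_le_iff₀ gpos] at t5
  have hT : 0 < T := by linarith
  have hT' : 200 * δ ^ 2 * T ^ 2 + T * (8 + 4 * m) * m ≤ 8 * δ ^ 2 * s ^ 4 * T ^ 3 := by
    have e1 := mul_le_mul_of_nonneg_left t2 (sq_nonneg T)
    have e2 : 0 ≤ (T ^ 2 - T) * ((8 + 4 * m) * m) :=
      mul_nonneg (by nlinarith) (by positivity)
    nlinarith
  have hT2 : T + C + 64 * C * δ ^ 2 * s ^ 2 * T ^ 2 ≤ a * T ^ 3 := by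
    have e1 := mul_le_mul_of_nonneg_left t3 (sq_nonneg T)
    have e2 : 0 ≤ (T ^ 2 - 1) * C := mul_nonneg (by nlinarith) hC
    nlinarith
  set w : Fin n → EuclideanSpace ℝ (Fin m) → ℝ := fun α x => wt z c κ T x * v α x with hwdef
  have hw : ∀ α, ContDiff ℝ 2 (w α) := fun α => (contDiff_wt z c κ T).mul (hv α)
  have hwts : ∀ α, tsupport (w α) ⊆ tsupport (v α) := fun α => tsupport_mul_subset_right
  have hwc : ∀ α, HasCompactSupport (w α) := fun α => compactSupport_mul_of_left' (hc α)
  have car := fun α => carleman z hδ hs hδs hT hT' (hw α) (hwc α)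
    (fun x hx => hsupp α x (hwts α hx))
  have iG : ∀ α, Integrable (gsq (w α)) := fun α =>
    (continuous_gsq (hw α)).integrable_of_hasCompactSupport
      (HasCompactSupport.intro (hwc α) fun x hx => (w_zero hx).2.1)
  have iw : ∀ α, Integrable (fun x => w α x ^ 2) := fun α =>
    ((hw α).continuous.pow 2).integrable_of_hasCompactSupport
      (HasCompactSupport.intro (hwc α) fun x hx => by simp [(w_zero hx).1])
  have iL : ∀ α, Integrable (fun x => (Lop z c T (w α) x) ^ 2) := fun α => by
    have : (fun x => (Lop z c T (w α) x) ^ 2) = fun x => (wt z c κ T x * lap (v α) x) ^ 2 := by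
      funext x; rw [Lop_wt_mul z c κ T (hv α)]
    rw [this]
    refine Continuous.integrable_of_hasCompactSupport ?_
      (HasCompactSupport.intro (hc α) fun x hx => by simp [(w_zero hx).2.2.1])
    exact ((contDiff_wt z c κ T (n := 1)).continuous.mul (continuous_lap (hv α))).pow 2
  have wt_le : ∀ x, S ≤ rho z x → rho z x ≤ s ^ 2 + δ → wt z c κ T x ^ 2 ≤ 1 := by
    intro x h1 h2
    have : wt z c κ T x ≤ 1 := by
      unfold wt
      rw [Real.exp_le_one_iff]
      refine mul_nonpos_of_nonneg_of_nonpos (by positivity) ?_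
      rw [hκ, hcdef]
      nlinarith
    exact pow_le_one₀ (Real.exp_pos _).le this
  have wt_ge : ∀ x, rho z x < S → 1 ≤ wt z c κ T x ^ 2 := by
    intro x h1
    have : 1 ≤ wt z c κ T x := by
      unfold wt
      refine Real.one_le_exp (mul_nonneg (by positivity) ?_)
      rw [hκ, hcdef]
      nlinarith
    exact one_le_pow₀ this
  have key : ∀ x, ∑ α, (Lop z c T (w α) x) ^ 2 ≤
      (∑ α, ((C + 64 * C * δ ^ 2 * s ^ 2 * T ^ 2) * w α x ^ 2 + (2 * C) * gsq (w α) x))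
      + ∑ α, lap (v α) x ^ 2 := by
    intro x
    have e0 : ∑ α, (Lop z c T (w α) x) ^ 2 = wt z c κ T x ^ 2 * ∑ α, lap (v α) x ^ 2 := by
      rw [Finset.mul_sum]
      refine Finset.sum_congr rfl fun α _ => ?_
      rw [Lop_wt_mul z c κ T (hv α)]; ring
    have hF0 : 0 ≤ ∑ α, lap (v α) x ^ 2 := Finset.sum_nonneg fun α _ => sq_nonneg _
    have g0 : ∀ α, 0 ≤ gsq (w α) x := fun α => Finset.sum_nonneg fun i _ => sq_nonneg _
    rw [e0]
    by_cases hx : rho z x < S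
    · have h1 := mul_le_mul_of_nonneg_left (hineq x hx) (sq_nonneg (wt z c κ T x))
      have h2 : wt z c κ T x ^ 2 * (C * ∑ α, (v α x ^ 2 + gsq (v α) x)) ≤
          ∑ α, ((C + 64 * C * δ ^ 2 * s ^ 2 * T ^ 2) * w α x ^ 2 + (2 * C) * gsq (w α) x) := by
        rw [mul_left_comm, Finset.mul_sum, Finset.mul_sum]
        refine Finset.sum_le_sum fun α _ => ?_
        have h3 := gsq_wt_mul z c κ T (hv α) x
        have h4 : 8 * T ^ 2 * (c - rho z x) ^ 2 * rho z x * (w α x) ^ 2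
            ≤ 64 * δ ^ 2 * s ^ 2 * T ^ 2 * w α x ^ 2 := by
          by_cases hxs : x ∈ tsupport (v α)
          · obtain ⟨h5, h6⟩ := hsupp α x hxs
            have h7 : (c - rho z x) ^ 2 ≤ (2 * δ) ^ 2 := by
              apply pow_le_pow_left₀ <;> rw [hcdef] <;> linarith
            have h8 : rho z x ≤ 2 * s ^ 2 := by linarith
            calc 8 * T ^ 2 * (c - rho z x) ^ 2 * rho z x * (w α x) ^ 2
                ≤ 8 * T ^ 2 * (2 * δ) ^ 2 * (2 * s ^ 2) * (w α x) ^ 2 := by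
                  gcongr
                  exact (sq_nonneg s).trans h5
              _ = _ := by ring
          · simp [w, (w_zero hxs).1]
        have h9 : wt z c κ T x ^ 2 * gsq (v α) x
            ≤ 2 * gsq (w α) x + 64 * δ ^ 2 * s ^ 2 * T ^ 2 * w α x ^ 2 := h3.trans (by
              have := h4; simp only [w] at this ⊢; linarith)
        have h10 := mul_le_mul_of_nonneg_left h9 hC
        have h11 : wt z c κ T x ^ 2 * v α x ^ 2 = w α x ^ 2 := by simp only [w]; ring
        have h12 : C * (wt z c κ T x ^ 2 * v α x ^ 2) = C * w α x ^ 2 := by rw [h11]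
        linarith
      linarith
    · have h2 : 0 ≤ ∑ α, ((C + 64 * C * δ ^ 2 * s ^ 2 * T ^ 2) * w α x ^ 2
          + (2 * C) * gsq (w α) x) :=
        Finset.sum_nonneg fun α _ => by have := g0 α; positivity
      have h3 : wt z c κ T x ^ 2 * ∑ α, lap (v α) x ^ 2 ≤ ∑ α, lap (v α) x ^ 2 := by
        by_cases hx2 : rho z x ≤ s ^ 2 + δ
        · exact mul_le_of_le_one_left hF0 (wt_le x (not_lt.1 hx) hx2)
        · have : ∑ α, lap (v α) x ^ 2 = 0 := Finset.sum_eq_zero fun α _ => by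
            have : x ∉ tsupport (v α) := fun h => hx2 (hsupp α x h).2
            simp [(w_zero this).2.2.1]
          simp [this]
      linarith
  have iA : ∀ α ∈ Finset.univ, Integrable (fun x =>
      (C + 64 * C * δ ^ 2 * s ^ 2 * T ^ 2) * w α x ^ 2 + (2 * C) * gsq (w α) x) := fun α _ =>
    ((iw α).const_mul _).add ((iG α).const_mul _)
  have int1 := integral_mono (integrable_finsetSum _ fun α _ => iL α)
    ((integrable_finsetSum _ iA).add (integrable_finsetSum _ fun α _ => iF α)) key
  rw [integral_add' (integrable_finsetSum _ iA) (integrable_finsetSum _ fun α _ => iF α),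
    integral_finsetSum _ (fun α _ => iL α), integral_finsetSum _ iA] at int1
  have e2 : ∀ α, ∫ x, ((C + 64 * C * δ ^ 2 * s ^ 2 * T ^ 2) * w α x ^ 2 + (2 * C) * gsq (w α) x)
      = (C + 64 * C * δ ^ 2 * s ^ 2 * T ^ 2) * (∫ x, w α x ^ 2) + 2 * C * ∫ x, gsq (w α) x := by
    intro α
    rw [integral_add ((iw α).const_mul _) ((iG α).const_mul _), integral_const_mul,
      integral_const_mul]
  have e3 : ∀ α, T * (∫ x, w α x ^ 2) +
      ((C + 64 * C * δ ^ 2 * s ^ 2 * T ^ 2) * (∫ x, w α x ^ 2) + 2 * C * ∫ x, gsq (w α) x)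
      ≤ ∫ x, (Lop z c T (w α) x) ^ 2 := by
    intro α
    refine le_trans ?_ (car α)
    have n1 : 0 ≤ ∫ x, w α x ^ 2 := integral_nonneg fun x => sq_nonneg _
    have n2 : 0 ≤ ∫ x, gsq (w α) x :=
      integral_nonneg fun x => Finset.sum_nonneg fun i _ => sq_nonneg _
    have m1 := mul_le_mul_of_nonneg_right hT2 n1
    have m2 := mul_le_mul_of_nonneg_right t4 n2
    rw [ha] at m1
    linarith
  have e4 := Finset.sum_le_sum fun α (_ : α ∈ Finset.univ) => e3 α
  rw [Finset.sum_add_distrib] at e4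
  simp only [e2] at int1
  have e5 : ∑ α, T * (∫ x, w α x ^ 2) ≤ J := by linarith
  have e6 : T * (∫ x, w α₀ x ^ 2) ≤ J := by
    refine le_trans ?_ e5
    exact Finset.single_le_sum (f := fun α => T * (∫ x, w α x ^ 2))
      (fun α _ => mul_nonneg hT.le (integral_nonneg fun x => sq_nonneg _)) (Finset.mem_univ α₀)
  have e7 : I ≤ S * ∫ x, w α₀ x ^ 2 := by
    rw [← integral_const_mul]
    refine integral_mono (gcont.integrable_of_hasCompactSupport gsupp) ((iw α₀).const_mul _) ?_
    intro x
    by_cases hx : rho z x < S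
    · have h1 := wt_ge x hx
      have h2 : 0 ≤ rho z x := Finset.sum_nonneg fun i _ => sq_nonneg _
      have h3 : max 0 (S - rho z x) ≤ S := max_le hSpos.le (by linarith)
      have h4 : v α₀ x ^ 2 ≤ w α₀ x ^ 2 := by
        simp only [w, mul_pow]; exact le_mul_of_one_le_left (sq_nonneg _) h1
      exact mul_le_mul h3 h4 (sq_nonneg _) hSpos.le
    · have : max 0 (S - rho z x) = 0 := max_eq_left (by linarith)
      change max 0 (S - rho z x) * v α₀ x ^ 2 ≤ S * w α₀ x ^ 2
      rw [this, zero_mul]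
      positivity
  have e8 := mul_le_mul_of_nonneg_left e7 hT.le
  have e9 := mul_le_mul_of_nonneg_left e6 hSpos.le
  linarith

end absorb

section main

variable {m n : ℕ}

lemma norm_pd_le (f : EuclideanSpace ℝ (Fin m) → EuclideanSpace ℝ (Fin n)) (i : Fin m) (x) :
    ‖pd f i x‖ ≤ ‖fderiv ℝ f x‖ := by
  have := (fderiv ℝ f x).le_opNorm (EuclideanSpace.single i (1:ℝ))
  simpa [pd] using this

lemma quad_diff (Q Q' : EuclideanSpace ℝ (Fin n) →L[ℝ] EuclideanSpace ℝ (Fin n) →L[ℝ]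
      EuclideanSpace ℝ (Fin n)) (a b : EuclideanSpace ℝ (Fin n)) {B N l : ℝ}
    (ha : ‖a‖ ≤ B) (hb : ‖b‖ ≤ B) (hN : ‖Q'‖ ≤ N) (hl : ‖Q - Q'‖ ≤ l) :
    ‖Q a a - Q' b b‖ ≤ l * B ^ 2 + 2 * N * B * ‖a - b‖ := by
  have hB : 0 ≤ B := (norm_nonneg a).trans ha
  have hN0 : 0 ≤ N := (norm_nonneg Q').trans hN
  have e : Q a a - Q' b b = (Q - Q') a a + Q' (a - b) a + Q' b (a - b) := by
    simp only [map_sub, ContinuousLinearMap.sub_apply]; abel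
  have hl0 : 0 ≤ l := (norm_nonneg (Q - Q')).trans hl
  have h1 : ‖(Q - Q') a a‖ ≤ l * B * B :=
    ((Q - Q').le_opNorm₂ a a).trans (by gcongr)
  have h2 : ‖Q' (a - b) a‖ ≤ N * ‖a - b‖ * B := (Q'.le_opNorm₂ _ _).trans (by gcongr)
  have h3 : ‖Q' b (a - b)‖ ≤ N * B * ‖a - b‖ := (Q'.le_opNorm₂ _ _).trans (by gcongr)
  rw [e]
  refine (norm_add₃_le).trans ?_
  linarith

lemma diff_ineq
    {D : Set (EuclideanSpace ℝ (Fin m))} (hD : IsOpen D)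
    (Γ A : EuclideanSpace ℝ (Fin n) →
      EuclideanSpace ℝ (Fin n) →L[ℝ] EuclideanSpace ℝ (Fin n) →L[ℝ] EuclideanSpace ℝ (Fin n))
    (hΓ : ContDiff ℝ (⊤ : ℕ∞) Γ) (hA : ContDiff ℝ (⊤ : ℕ∞) A)
    (φ φ' : EuclideanSpace ℝ (Fin m) → EuclideanSpace ℝ (Fin n))
    (hφ : ContDiffOn ℝ 2 φ D) (hφ' : ContDiffOn ℝ 2 φ' D)
    (heq : ∀ x ∈ D,
      ∑ i, pd (pd φ i) i x + ∑ i, Γ (φ x) (pd φ i x) (pd φ i x)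
        + ∑ i, A (φ x) (pd φ i x) (pd φ i x) = 0)
    (heq' : ∀ x ∈ D,
      ∑ i, pd (pd φ' i) i x + ∑ i, Γ (φ' x) (pd φ' i x) (pd φ' i x)
        + ∑ i, A (φ' x) (pd φ' i x) (pd φ' i x) = 0)
    {K : Set (EuclideanSpace ℝ (Fin m))} (hK : IsCompact K) (hKD : K ⊆ D) :
    ∃ C : ℝ, 0 ≤ C ∧ ∀ x ∈ K, ‖∑ i, (pd (pd φ i) i x - pd (pd φ' i) i x)‖ ^ 2
      ≤ C * (‖φ x - φ' x‖ ^ 2 + ∑ i, ‖pd φ i x - pd φ' i x‖ ^ 2) := by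
  obtain ⟨B1, hB1⟩ := hK.exists_bound_of_continuousOn (hφ.continuousOn.mono hKD)
  obtain ⟨B2, hB2⟩ := hK.exists_bound_of_continuousOn (hφ'.continuousOn.mono hKD)
  obtain ⟨B3, hB3⟩ := hK.exists_bound_of_continuousOn
    ((hφ.continuousOn_fderiv_of_isOpen hD (by norm_num)).mono hKD)
  obtain ⟨B4, hB4⟩ := hK.exists_bound_of_continuousOn
    ((hφ'.continuousOn_fderiv_of_isOpen hD (by norm_num)).mono hKD)
  set B := max 0 (max (max B1 B2) (max B3 B4)) with hB
  have hB0 : 0 ≤ B := le_max_left _ _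
  have b1 : B1 ≤ B := by simp [hB]
  have b2 : B2 ≤ B := by simp [hB]
  have b3 : B3 ≤ B := by simp [hB]
  have b4 : B4 ≤ B := by simp [hB]
  set Q := fun y => Γ y + A y with hQ
  have hQc : ContDiff ℝ (⊤ : ℕ∞) Q := hΓ.add hA
  have hcomp : IsCompact (Metric.closedBall (0 : EuclideanSpace ℝ (Fin n)) B) :=
    isCompact_closedBall _ _
  obtain ⟨L, hL⟩ := hQc.contDiffOn.exists_lipschitzOnWith (by simp) (convex_closedBall _ _) hcomp
  have hz0 : (0 : EuclideanSpace ℝ (Fin n)) ∈ Metric.closedBall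
      (0 : EuclideanSpace ℝ (Fin n)) B := by simp [hB0]
  have hNex : ∃ N : ℝ, ∀ y ∈ Metric.closedBall (0 : EuclideanSpace ℝ (Fin n)) B, ‖Q y‖ ≤ N := by
    refine ⟨L * B + ‖Q 0‖, fun y hy => ?_⟩
    have h1 : ‖Q y - Q 0‖ ≤ L * ‖y - 0‖ := hL.norm_sub_le hy hz0
    have h2 : ‖y - 0‖ ≤ B := by simpa using hy
    have h3 : (L : ℝ) * ‖y - 0‖ ≤ L * B := mul_le_mul_of_nonneg_left h2 L.2
    have h4 : ‖Q y‖ ≤ ‖Q y - Q 0‖ + ‖Q 0‖ := by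
      have := norm_add_le (Q y - Q 0) (Q 0)
      have e0 : Q y - Q 0 + Q 0 = Q y := by
        ext v w : 2
        simp
      rwa [e0] at this
    linarith
  obtain ⟨N, hN⟩ := hNex
  have hN0 : 0 ≤ N := (norm_nonneg (Q 0)).trans (hN 0 (by simp [hB0]))
  set C0 := m * (L * B ^ 2) + 2 * N * B with hC0
  have hC00 : 0 ≤ C0 := by positivity
  refine ⟨C0 ^ 2 * (2 + 2 * m), by positivity, fun x hx => ?_⟩
  have hxD := hKD hx
  have p1 : φ x ∈ Metric.closedBall (0 : EuclideanSpace ℝ (Fin n)) B := by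
    simpa using (hB1 x hx).trans b1
  have p2 : φ' x ∈ Metric.closedBall (0 : EuclideanSpace ℝ (Fin n)) B := by
    simpa using (hB2 x hx).trans b2
  have hl : ‖Q (φ x) - Q (φ' x)‖ ≤ L * ‖φ x - φ' x‖ := hL.norm_sub_le p1 p2
  have e : ∑ i, (pd (pd φ i) i x - pd (pd φ' i) i x)
      = - ∑ i, (Q (φ x) (pd φ i x) (pd φ i x) - Q (φ' x) (pd φ' i x) (pd φ' i x)) := by
    have h1 := heq x hxD
    have h2 := heq' x hxD
    rw [add_assoc] at h1 h2
    simp only [hQ, ContinuousLinearMap.add_apply, Finset.sum_sub_distrib, Finset.sum_add_distrib]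
    rw [eq_neg_of_add_eq_zero_left h1, eq_neg_of_add_eq_zero_left h2]
    abel
  set d := fun i => ‖pd φ i x - pd φ' i x‖ with hd
  set S := ∑ i, d i with hS
  have hS0 : 0 ≤ S := Finset.sum_nonneg fun i _ => norm_nonneg _
  have bound : ‖∑ i, (pd (pd φ i) i x - pd (pd φ' i) i x)‖ ≤ C0 * (‖φ x - φ' x‖ + S) := by
    rw [e, norm_neg]
    refine (norm_sum_le _ _).trans ?_
    have : ∀ i ∈ Finset.univ,
        ‖Q (φ x) (pd φ i x) (pd φ i x) - Q (φ' x) (pd φ' i x) (pd φ' i x)‖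
        ≤ L * ‖φ x - φ' x‖ * B ^ 2 + 2 * N * B * d i := fun i _ =>
      quad_diff _ _ _ _ ((norm_pd_le φ i x).trans ((hB3 x hx).trans b3))
        ((norm_pd_le φ' i x).trans ((hB4 x hx).trans b4)) (hN _ p2) hl
    refine (Finset.sum_le_sum this).trans ?_
    rw [Finset.sum_add_distrib, ← Finset.mul_sum Finset.univ d (2 * N * B), ← hS]
    simp only [Finset.sum_const, Finset.card_univ, Fintype.card_fin, nsmul_eq_mul]
    have q1 : 0 ≤ (m * (L * B ^ 2)) * S := by positivity
    have q2 : 0 ≤ 2 * N * B * ‖φ x - φ' x‖ := by positivity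
    rw [hC0]
    linarith
  have hsq : S ^ 2 ≤ m * ∑ i, d i ^ 2 := by
    have := sq_sum_le_card_mul_sum_sq (s := Finset.univ) (f := d)
    simpa using this
  have h3 : (‖φ x - φ' x‖ + S) ^ 2 ≤ (2 + 2 * m) * (‖φ x - φ' x‖ ^ 2 + ∑ i, d i ^ 2) := by
    have r1 : 0 ≤ ∑ i, d i ^ 2 := Finset.sum_nonneg fun i _ => sq_nonneg _
    have r2 : 0 ≤ (m : ℝ) * ‖φ x - φ' x‖ ^ 2 := by positivity
    nlinarith [sq_nonneg (‖φ x - φ' x‖ - S)]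
  calc _ ≤ (C0 * (‖φ x - φ' x‖ + S)) ^ 2 := pow_le_pow_left₀ (norm_nonneg _) bound 2
    _ = C0 ^ 2 * (‖φ x - φ' x‖ + S) ^ 2 := by ring
    _ ≤ C0 ^ 2 * ((2 + 2 * m) * (‖φ x - φ' x‖ ^ 2 + ∑ i, d i ^ 2)) := by gcongr
    _ = _ := by ring

lemma pd_comp_coord {f : EuclideanSpace ℝ (Fin m) → EuclideanSpace ℝ (Fin n)} {x}
    (hf : DifferentiableAt ℝ f x) (α : Fin n) (i : Fin m) :
    pd (fun y => f y α) i x = pd f i x α := by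
  have := ((EuclideanSpace.proj α : EuclideanSpace ℝ (Fin n) →L[ℝ] ℝ).hasFDerivAt.comp x
    hf.hasFDerivAt).fderiv
  have h2 : (fun y => f y α) = (EuclideanSpace.proj α : EuclideanSpace ℝ (Fin n) →L[ℝ] ℝ) ∘ f := by
    funext y; simp
  unfold pd
  rw [h2, this]
  simp

lemma pd_congr {F : Type*} [NormedAddCommGroup F] [NormedSpace ℝ F]
    {f g : EuclideanSpace ℝ (Fin m) → F} {x} (h : f =ᶠ[nhds x] g) (i : Fin m) :
    pd f i x = pd g i x := by
  unfold pd; rw [h.fderiv_eq]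

lemma grow
    {D : Set (EuclideanSpace ℝ (Fin m))} (hD : IsOpen D)
    (φ φ' : EuclideanSpace ℝ (Fin m) → EuclideanSpace ℝ (Fin n))
    (hφ : ContDiffOn ℝ 2 φ D) (hφ' : ContDiffOn ℝ 2 φ' D)
    {z : EuclideanSpace ℝ (Fin m)} {R C s : ℝ} (hR : Metric.closedBall z R ⊆ D) (hC : 0 ≤ C)
    (hineq : ∀ x ∈ Metric.closedBall z R, ‖∑ i, (pd (pd φ i) i x - pd (pd φ' i) i x)‖ ^ 2
      ≤ C * (‖φ x - φ' x‖ ^ 2 + ∑ i, ‖pd φ i x - pd φ' i x‖ ^ 2))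
    (hs : 0 < s) (hsR : s < R) (hz : Set.EqOn φ φ' (Metric.ball z s)) :
    ∃ s' > s, Set.EqOn φ φ' (Metric.ball z s') := by
  set δ := min (s ^ 2 / 3) (R ^ 2 - s ^ 2) with hδdef
  have hδ : 0 < δ := lt_min (by positivity) (by nlinarith)
  have hδ1 : 3 * δ ≤ s ^ 2 := by have := min_le_left (s ^ 2 / 3) (R ^ 2 - s ^ 2); linarith
  have hδ2 : s ^ 2 + δ ≤ R ^ 2 := by have := min_le_right (s ^ 2 / 3) (R ^ 2 - s ^ 2); linarith
  set rI := Real.sqrt (s ^ 2 + δ / 2) with hrI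
  set rO := Real.sqrt (s ^ 2 + δ) with hrO
  have rI2 : rI ^ 2 = s ^ 2 + δ / 2 := Real.sq_sqrt (by positivity)
  have rO2 : rO ^ 2 = s ^ 2 + δ := Real.sq_sqrt (by positivity)
  have rI0 : 0 < rI := Real.sqrt_pos.2 (by positivity)
  have hrlt : rI < rO := Real.sqrt_lt_sqrt (by positivity) (by linarith)
  have rO0 : 0 < rO := rI0.trans hrlt
  have rOR : rO ≤ R := by
    exact Real.sqrt_le_iff.2 ⟨by linarith, hδ2⟩
  have srI : s < rI := by
    apply lt_of_pow_lt_pow_left₀ 2 rI0.le; linarith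
  let χ : ContDiffBump z := ⟨rI, rO, rI0, hrlt⟩
  have hχs : tsupport χ ⊆ D := by
    rw [χ.tsupport_eq]
    exact (Metric.closedBall_subset_closedBall rOR).trans hR
  set V : EuclideanSpace ℝ (Fin m) → EuclideanSpace ℝ (Fin n) :=
    fun x => χ x • (φ x - φ' x) with hV
  have hVts : tsupport V ⊆ tsupport χ := tsupport_smul_subset_left _ _
  have hVc : HasCompactSupport V := χ.hasCompactSupport.smul_right
  have hVd : ContDiff ℝ 2 V := by
    rw [contDiff_iff_contDiffAt]
    intro x
    by_cases hx : x ∈ tsupport V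
    · have hxD := hχs (hVts hx)
      have hn := hD.mem_nhds hxD
      exact χ.contDiff.contDiffAt.smul ((hφ.contDiffAt hn).sub (hφ'.contDiffAt hn))
    · have : V =ᶠ[nhds x] fun _ => 0 := notMem_tsupport_iff_eventuallyEq.1 hx
      exact contDiffAt_const.congr_of_eventuallyEq this
  have hlt : ∀ x r, 0 < r → (rho z x < r ^ 2 ↔ x ∈ Metric.ball z r) := by
    intro x r hr
    rw [rho_eq, mem_ball_iff_norm]
    exact pow_lt_pow_iff_left₀ (norm_nonneg _) hr.le (by norm_num)
  have hVsupp : ∀ x ∈ tsupport V, s ^ 2 ≤ rho z x ∧ rho z x ≤ s ^ 2 + δ := by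
    have hr := (contDiff_rho z (n := 1)).continuous
    have hcl : IsClosed {x | s ^ 2 ≤ rho z x ∧ rho z x ≤ s ^ 2 + δ} :=
      (isClosed_le continuous_const hr).inter (isClosed_le hr continuous_const)
    refine closure_minimal (fun x hx => ?_) hcl
    have h1 : χ x ≠ 0 := fun h => hx (by simp [hV, h])
    have h2 : φ x ≠ φ' x := fun h => hx (by simp [hV, h])
    constructor
    · by_contra hlt'
      exact h2 (hz ((hlt x s hs).1 (not_le.1 hlt')))
    · have : x ∈ Function.support χ := h1
      rw [χ.support_eq] at this
      have := (hlt x rO rO0).2 this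
      linarith
  set v : Fin n → EuclideanSpace ℝ (Fin m) → ℝ := fun α x => V x α with hv
  have hvd : ∀ α, ContDiff ℝ 2 (v α) := fun α =>
    (EuclideanSpace.proj α : EuclideanSpace ℝ (Fin n) →L[ℝ] ℝ).contDiff.comp hVd
  have hvts : ∀ α, tsupport (v α) ⊆ tsupport V := fun α => by
    refine closure_mono fun x hx => ?_
    intro h
    exact hx (by simp [hv, h])
  have hvc : ∀ α, HasCompactSupport (v α) := fun α =>
    HasCompactSupport.intro hVc fun x hx => by
      simp [hv, image_eq_zero_of_notMem_tsupport hx]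
  have hvpd : ∀ α i x, pd (v α) i x = pd V i x α := fun α i x =>
    pd_comp_coord (hVd.differentiable (by norm_num) x) α i
  have hvpd2 : ∀ α i x, pd (pd (v α) i) i x = pd (pd V i) i x α := fun α i x => by
    have : pd (v α) i = fun y => pd V i y α := funext fun y => hvpd α i y
    rw [this]
    exact pd_comp_coord ((contDiff_pd hVd i).differentiable (by norm_num) x) α i
  have hineq' : ∀ x, rho z x < s ^ 2 + δ / 2 →
      ∑ α, lap (v α) x ^ 2 ≤ C * ∑ α, (v α x ^ 2 + gsq (v α) x) := by
    intro x hx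
    rw [← rI2, hlt x rI rI0] at hx
    have hsub : Metric.ball z rI ⊆ D :=
      (Metric.ball_subset_closedBall.trans (Metric.closedBall_subset_closedBall
        (hrlt.le.trans rOR))).trans hR
    have hev : ∀ y ∈ Metric.ball z rI, V =ᶠ[nhds y] fun x => φ x - φ' x := fun y hy => by
      filter_upwards [Metric.isOpen_ball.mem_nhds hy] with x hx
      have : χ x = 1 := χ.one_of_mem_closedBall (Metric.ball_subset_closedBall hx)
      simp [hV, this]
    have dφ : ∀ y ∈ Metric.ball z rI, ContDiffAt ℝ 2 φ y := fun y hy =>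
      hφ.contDiffAt (hD.mem_nhds (hsub hy))
    have dφ' : ∀ y ∈ Metric.ball z rI, ContDiffAt ℝ 2 φ' y := fun y hy =>
      hφ'.contDiffAt (hD.mem_nhds (hsub hy))
    have p1 : ∀ i, ∀ y ∈ Metric.ball z rI, pd V i y = pd φ i y - pd φ' i y := fun i y hy => by
      rw [pd_congr (hev y hy)]
      unfold pd
      rw [fderiv_fun_sub ((dφ y hy).differentiableAt (by norm_num))
        ((dφ' y hy).differentiableAt (by norm_num))]
      simp
    have dpd : ∀ {f : EuclideanSpace ℝ (Fin m) → EuclideanSpace ℝ (Fin n)},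
        ContDiffAt ℝ 2 f x → ∀ i, DifferentiableAt ℝ (pd f i) x := fun {f} hf i =>
      ((hf.fderiv_right (m := 1) (by norm_num)).differentiableAt (by norm_num)).clm_apply
        (differentiableAt_const _)
    have p2 : ∀ i, pd (pd V i) i x = pd (pd φ i) i x - pd (pd φ' i) i x := fun i => by
      have : pd V i =ᶠ[nhds x] fun y => pd φ i y - pd φ' i y := by
        filter_upwards [Metric.isOpen_ball.mem_nhds hx] with y hy using p1 i y hy
      rw [pd_congr this, pd, fderiv_fun_sub (dpd (dφ x hx) i) (dpd (dφ' x hx) i)]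
      simp [pd]
    have hxR : x ∈ Metric.closedBall z R :=
      Metric.closedBall_subset_closedBall (hrlt.le.trans rOR) (Metric.ball_subset_closedBall hx)
    have h := hineq x hxR
    have e1 : ∑ α, lap (v α) x ^ 2 = ‖∑ i, (pd (pd φ i) i x - pd (pd φ' i) i x)‖ ^ 2 := by
      rw [EuclideanSpace.norm_sq_eq]
      refine Finset.sum_congr rfl fun α _ => ?_
      rw [Real.norm_eq_abs, sq_abs, lap]
      congr 1
      simp only [hvpd2, p2]
      simp
    have e2 : ∑ α, (v α x ^ 2 + gsq (v α) x)
        = ‖φ x - φ' x‖ ^ 2 + ∑ i, ‖pd φ i x - pd φ' i x‖ ^ 2 := by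
      rw [Finset.sum_add_distrib]
      congr 1
      · rw [← (hev x hx).eq_of_nhds, EuclideanSpace.norm_sq_eq]
        exact Finset.sum_congr rfl fun α _ => by rw [Real.norm_eq_abs, sq_abs]
      · simp only [gsq]
        rw [Finset.sum_comm]
        refine Finset.sum_congr rfl fun i _ => ?_
        rw [← p1 i x hx, EuclideanSpace.norm_sq_eq]
        exact Finset.sum_congr rfl fun α _ => by rw [Real.norm_eq_abs, sq_abs, hvpd]
    rw [e1, e2]
    exact h
  have fin := absorb z hδ hs (by positivity : 0 < δ / 2) (by linarith) hδ1 hC v hvd hvc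
    (fun α x hx => hVsupp x (hvts α hx)) hineq'
  refine ⟨rI, srI, fun x hx => ?_⟩
  have h0 : V x = 0 := by
    ext α
    have := fin α x (by rw [← rI2]; exact (hlt x rI rI0).2 hx)
    simpa [hv] using this
  have : χ x = 1 := χ.one_of_mem_closedBall (Metric.ball_subset_closedBall hx)
  simpa [hV, this, sub_eq_zero] using h0

lemma fill_ball {φ φ' : EuclideanSpace ℝ (Fin m) → EuclideanSpace ℝ (Fin n)}
    {z : EuclideanSpace ℝ (Fin m)} {R s₀ : ℝ}
    (hgrow : ∀ s, 0 < s → s < R → Set.EqOn φ φ' (Metric.ball z s) →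
      ∃ s' > s, Set.EqOn φ φ' (Metric.ball z s'))
    (hs : 0 < s₀) (hsR : s₀ < R) (hz : Set.EqOn φ φ' (Metric.ball z s₀)) :
    Set.EqOn φ φ' (Metric.ball z R) := by
  set A := {r : ℝ | r ≤ R ∧ Set.EqOn φ φ' (Metric.ball z r)} with hA
  have hne : A.Nonempty := ⟨s₀, hsR.le, hz⟩
  have hbdd : BddAbove A := ⟨R, fun r hr => hr.1⟩
  set t := sSup A with ht
  have hst : s₀ ≤ t := le_csSup hbdd ⟨hsR.le, hz⟩
  have htR : t ≤ R := csSup_le hne fun r hr => hr.1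
  have heq : Set.EqOn φ φ' (Metric.ball z t) := by
    intro x hx
    obtain ⟨r, hr, hxr⟩ := exists_lt_of_lt_csSup hne (Metric.mem_ball.1 hx)
    exact hr.2 hxr
  rcases htR.eq_or_lt with h | h
  · rwa [h] at heq
  · obtain ⟨s', h1, h2⟩ := hgrow t (hs.trans_le hst) h heq
    have : min s' R ≤ t := le_csSup hbdd
      ⟨min_le_right _ _, h2.mono (Metric.ball_subset_ball (min_le_left _ _))⟩
    exact absurd this (not_le.2 (lt_min h1 h))

end main

/-- Unique continuation for harmonic maps with torsion (Euclidean coordinate version):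
two `C²` solutions `φ, φ'` of the harmonic map with torsion system
`Δφ + ∑ᵢ Γ(φ)(∂ᵢφ, ∂ᵢφ) + ∑ᵢ A(φ)(∂ᵢφ, ∂ᵢφ) = 0` on a connected open set `D ⊆ ℝ^m`
that agree on a nonempty open subset `W ⊆ D` agree on all of `D`. Here `Γ` and `A` are
smooth fields of bilinear maps on `ℝⁿ` (the Christoffel symbols and torsion
endomorphism in local coordinates). -/
theorem unique_continuation_harmonic_maps_with_torsion
    {m n : ℕ}
    (D : Set (EuclideanSpace ℝ (Fin m))) (hD : IsOpen D) (hDconn : IsConnected D)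
    (Γ A : EuclideanSpace ℝ (Fin n) →
      EuclideanSpace ℝ (Fin n) →L[ℝ] EuclideanSpace ℝ (Fin n) →L[ℝ] EuclideanSpace ℝ (Fin n))
    (hΓ : ContDiff ℝ (⊤ : ℕ∞) Γ) (hA : ContDiff ℝ (⊤ : ℕ∞) A)
    (φ φ' : EuclideanSpace ℝ (Fin m) → EuclideanSpace ℝ (Fin n))
    (hφ : ContDiffOn ℝ 2 φ D) (hφ' : ContDiffOn ℝ 2 φ' D)
    (heq : ∀ x ∈ D,
      ∑ i, pd (pd φ i) i x + ∑ i, Γ (φ x) (pd φ i x) (pd φ i x)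
        + ∑ i, A (φ x) (pd φ i x) (pd φ i x) = 0)
    (heq' : ∀ x ∈ D,
      ∑ i, pd (pd φ' i) i x + ∑ i, Γ (φ' x) (pd φ' i x) (pd φ' i x)
        + ∑ i, A (φ' x) (pd φ' i x) (pd φ' i x) = 0)
    (W : Set (EuclideanSpace ℝ (Fin m))) (hW : IsOpen W) (hWne : W.Nonempty)
    (hWD : W ⊆ D) (hagree : Set.EqOn φ φ' W) :
    Set.EqOn φ φ' D := by
  set U := {x | ∀ᶠ y in nhds x, φ y = φ' y} with hU
  have hUo : IsOpen U := isOpen_setOf_eventually_nhds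
  have hsub : D ⊆ U := by
    refine hDconn.isPreconnected.subset_of_closure_inter_subset hUo ?_ ?_
    · obtain ⟨y, hy⟩ := hWne
      exact ⟨y, hWD hy, Filter.eventually_of_mem (hW.mem_nhds hy) fun x hx => hagree hx⟩
    · rintro x ⟨hxU, hxD⟩
      obtain ⟨ε, hε, hball⟩ := Metric.isOpen_iff.1 hD x hxD
      obtain ⟨z, hzU, hxz⟩ := Metric.mem_closure_iff.1 hxU (ε / 3) (by positivity)
      have hR : Metric.closedBall z (ε / 2) ⊆ D := by
        refine Set.Subset.trans (fun y hy => ?_) hball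
        rw [Metric.mem_closedBall] at hy
        rw [Metric.mem_ball]
        have := dist_triangle y z x
        rw [dist_comm z x] at this
        linarith
      obtain ⟨r, hr, hzr⟩ := Metric.eventually_nhds_iff_ball.1 hzU
      obtain ⟨C, hC, hineq⟩ := diff_ineq hD Γ A hΓ hA φ φ' hφ hφ' heq heq'
        (isCompact_closedBall z (ε / 2)) hR
      have hfill : Set.EqOn φ φ' (Metric.ball z (ε / 2)) := by
        refine fill_ball (s₀ := min r (ε / 4)) (fun s h1 h2 h3 =>
          grow hD φ φ' hφ hφ' hR hC hineq h1 h2 h3) (lt_min hr (by positivity))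
          (lt_of_le_of_lt (min_le_right _ _) (by linarith)) ?_
        intro y hy
        exact hzr y (Metric.ball_subset_ball (min_le_left _ _) hy)
      refine Filter.eventually_of_mem (Metric.isOpen_ball.mem_nhds ?_) fun y hy => hfill hy
      rw [Metric.mem_ball]
      linarith
  intro x hx
  exact (hsub hx).self_of_nhds
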